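/- The third derivative ξ'''(t) satisfies ξ'''(t) < 0 on (−π/2, 0) and ξ'''(t) > 0 on (0, π/2), where ξ(t) = (cos²t + 2t·sin t·cos t + t² − π²/4)/cos²t. -/

import Mathlib

open Real Set

noncomputable def xi (t : ℝ) : ℝ :=
  (Real.cos t ^ 2 + 2 * t * Real.sin t * Real.cos t + t ^ 2 - Real.pi ^ 2 / 4) / Real.cos t ^ 2

lemma hasDerivAt_tan_one_add_sq {t : ℝ} (h : cos t ≠ 0) :
    HasDerivAt tan (1 + tan t ^ 2) t := by
  have h1 := Real.hasDerivAt_tan h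
  rwa [one_div, ← Real.inv_one_add_tan_sq h, inv_inv] at h1

lemma xi_eq_tan {t : ℝ} (h : cos t ≠ 0) :
    xi t = 1 + 2 * t * tan t + (t ^ 2 - π ^ 2 / 4) * (1 + tan t ^ 2) := by
  rw [xi, Real.tan_eq_sin_div_cos]
  have := Real.sin_sq_add_cos_sq t
  field_simp
  linear_combination (-(4 * t ^ 2 - π ^ 2)) * this

lemma eventually_cos_ne_zero {t : ℝ} (h : cos t ≠ 0) : ∀ᶠ y in nhds t, cos y ≠ 0 :=
  Real.continuous_cos.continuousAt.eventually_ne h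

lemma deriv_xi {t : ℝ} (h : cos t ≠ 0) :
    deriv xi t = 2 * tan t + 4 * t * (1 + tan t ^ 2)
      + 2 * (t ^ 2 - π ^ 2 / 4) * (tan t + tan t ^ 3) := by
  have hT := hasDerivAt_tan_one_add_sq h
  have hi := hasDerivAt_id' t
  rw [Filter.EventuallyEq.deriv_eq ((eventually_cos_ne_zero h).mono fun y hy => xi_eq_tan hy)]
  have := (((hi.const_mul 2).mul hT).const_add 1).add
    (((hi.pow 2).sub_const (π ^ 2 / 4)).mul ((hT.pow 2).const_add 1))
  refine (this.congr_deriv ?_).deriv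
  simp
  ring

lemma deriv_deriv_xi {t : ℝ} (h : cos t ≠ 0) :
    deriv (deriv xi) t = 6 * (1 + tan t ^ 2) + 12 * t * (tan t + tan t ^ 3)
      + 2 * (t ^ 2 - π ^ 2 / 4) * (1 + 4 * tan t ^ 2 + 3 * tan t ^ 4) := by
  have hT := hasDerivAt_tan_one_add_sq h
  have hi := hasDerivAt_id' t
  rw [Filter.EventuallyEq.deriv_eq ((eventually_cos_ne_zero h).mono fun y hy => deriv_xi hy)]
  have := ((hT.const_mul 2).add ((hi.const_mul 4).mul ((hT.pow 2).const_add 1))).add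
    ((((hi.pow 2).sub_const (π ^ 2 / 4)).const_mul 2).mul (hT.add (hT.pow 3)))
  refine (this.congr_deriv ?_).deriv
  simp
  ring

lemma deriv_deriv_deriv_xi {t : ℝ} (h : cos t ≠ 0) :
    deriv (deriv (deriv xi)) t = 8 * (1 + tan t ^ 2) *
      (3 * tan t + 2 * t * (1 + 3 * tan t ^ 2)
        + (t ^ 2 - π ^ 2 / 4) * (2 * tan t + 3 * tan t ^ 3)) := by
  have hT := hasDerivAt_tan_one_add_sq h
  have hi := hasDerivAt_id' t
  rw [Filter.EventuallyEq.deriv_eq ((eventually_cos_ne_zero h).mono fun y hy => deriv_deriv_xi hy)]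
  have := ((((hT.pow 2).const_add 1).const_mul 6).add
      ((hi.const_mul 12).mul (hT.add (hT.pow 3)))).add
    ((((hi.pow 2).sub_const (π ^ 2 / 4)).const_mul 2).mul
      ((((hT.pow 2).const_mul 4).const_add 1).add ((hT.pow 4).const_mul 3)))
  refine (this.congr_deriv ?_).deriv
  simp
  ring

lemma two_mul_sin_mul_cos_lt {t : ℝ} (h0 : 0 < t) (h1 : t < π / 2) :
    2 * sin t * cos t < t * (2 - sin t ^ 2) := by
  have hmono : StrictMonoOn (fun t : ℝ => t * (2 - sin t ^ 2) - 2 * sin t * cos t)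
      (Icc 0 (π / 2)) := by
    refine strictMonoOn_of_deriv_pos (convex_Icc _ _) (by fun_prop) ?_
    rw [interior_Icc]
    rintro x ⟨hx0, hx1⟩
    have hs : 0 < sin x := Real.sin_pos_of_pos_of_lt_pi hx0 (by linarith)
    have hc : 0 < cos x := Real.cos_pos_of_mem_Ioo ⟨by linarith, hx1⟩
    have hxt := Real.lt_tan hx0 hx1
    rw [Real.tan_eq_sin_div_cos, lt_div_iff₀ hc] at hxt
    have hS := Real.hasDerivAt_sin x
    have hd := ((hasDerivAt_id' x).mul ((hS.pow 2).const_sub 2)).sub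
      ((hS.const_mul 2).mul (Real.hasDerivAt_cos x))
    have hd' : HasDerivAt (fun t : ℝ => t * (2 - sin t ^ 2) - 2 * sin t * cos t)
        (sin x * (3 * sin x - 2 * (x * cos x))) x := by
      refine hd.congr_deriv ?_
      simp
      linear_combination (-2) * Real.sin_sq_add_cos_sq x
    rw [hd'.deriv]
    exact mul_pos hs (by linarith)
  have := hmono ⟨le_rfl, by linarith⟩ ⟨h0.le, h1.le⟩ h0
  simp at this
  linarith

lemma sin_cos_combination_pos {t : ℝ} (h0 : 0 < t) (h1 : t < π / 2) :
    0 < 3 * sin t * cos t ^ 2 + 2 * t * cos t * (1 + 2 * sin t ^ 2)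
      + (t ^ 2 - π ^ 2 / 4) * (sin t * (2 + sin t ^ 2)) := by
  have hsin : ∀ x ∈ Ioc 0 (π / 2), 0 < sin x := fun x hx =>
    Real.sin_pos_of_pos_of_lt_pi hx.1 (by linarith [hx.2, Real.pi_pos])
  have hanti : StrictAntiOn (fun t : ℝ =>
      (3 * sin t * cos t ^ 2 + 2 * t * cos t * (1 + 2 * sin t ^ 2)) / (sin t * (2 + sin t ^ 2))
        + t ^ 2) (Ioc 0 (π / 2)) := by
    refine strictAntiOn_of_deriv_neg (convex_Ioc _ _) ?_ ?_
    · refine ContinuousOn.add (ContinuousOn.div (by fun_prop) (by fun_prop) ?_) (by fun_prop)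
      intro x hx
      have := hsin x hx
      positivity
    rw [interior_Ioc]
    rintro x ⟨hx0, hx1⟩
    have hs : 0 < sin x := hsin x ⟨hx0, hx1.le⟩
    have hc : 0 < cos x := Real.cos_pos_of_mem_Ioo ⟨by linarith, hx1⟩
    have hS := Real.hasDerivAt_sin x
    have hC := Real.hasDerivAt_cos x
    have hi := hasDerivAt_id' x
    have hne : sin x * (2 + sin x ^ 2) ≠ 0 := by positivity
    have hd := (((((hS.const_mul 3).mul (hC.pow 2)).add
      (((hi.const_mul 2).mul hC).mul (((hS.pow 2).const_mul 2).const_add 1))).div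
      (hS.mul ((hS.pow 2).const_add 2)) hne)).add (hi.pow 2)
    have hd' : HasDerivAt (fun t : ℝ =>
        (3 * sin t * cos t ^ 2 + 2 * t * cos t * (1 + 2 * sin t ^ 2)) / (sin t * (2 + sin t ^ 2))
          + t ^ 2)
        (2 * cos x ^ 4 / (sin x ^ 2 * (2 + sin x ^ 2) ^ 2)
          * (2 * sin x * cos x - x * (2 - sin x ^ 2))) x := by
      refine hd.congr_deriv ?_
      have hsc := Real.sin_sq_add_cos_sq x
      simp
      generalize sin x = s at *
      generalize cos x = c at *
      field_simp
      grind
    rw [hd'.deriv]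
    refine mul_neg_of_pos_of_neg (by positivity) ?_
    linarith [two_mul_sin_mul_cos_lt hx0 hx1]
  have hlt := hanti ⟨h0, h1.le⟩ ⟨by linarith, le_rfl⟩ h1
  have hs := hsin t ⟨h0, h1.le⟩
  have hD : 0 < sin t * (2 + sin t ^ 2) := by positivity
  simp only [Real.cos_pi_div_two, Real.sin_pi_div_two] at hlt
  have hlt' : π ^ 2 / 4 - t ^ 2 <
      (3 * sin t * cos t ^ 2 + 2 * t * cos t * (1 + 2 * sin t ^ 2)) /
        (sin t * (2 + sin t ^ 2)) := by
    norm_num at hlt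
    linarith
  rw [lt_div_iff₀ hD] at hlt'
  linarith

lemma deriv_deriv_deriv_xi_pos {t : ℝ} (h0 : 0 < t) (h1 : t < π / 2) :
    0 < deriv (deriv (deriv xi)) t := by
  have hc : 0 < cos t := Real.cos_pos_of_mem_Ioo ⟨by linarith, h1⟩
  rw [deriv_deriv_deriv_xi hc.ne']
  refine mul_pos (by positivity) ?_
  have key : 3 * tan t + 2 * t * (1 + 3 * tan t ^ 2)
        + (t ^ 2 - π ^ 2 / 4) * (2 * tan t + 3 * tan t ^ 3) =
      (3 * sin t * cos t ^ 2 + 2 * t * cos t * (1 + 2 * sin t ^ 2)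
        + (t ^ 2 - π ^ 2 / 4) * (sin t * (2 + sin t ^ 2))) / cos t ^ 3 := by
    have hsc := Real.sin_sq_add_cos_sq t
    rw [Real.tan_eq_sin_div_cos]
    generalize sin t = s at *
    generalize cos t = c at *
    field_simp
    grind
  rw [key]
  exact div_pos (sin_cos_combination_pos h0 h1) (by positivity)

lemma deriv_deriv_deriv_xi_neg {t : ℝ} (h : cos t ≠ 0) :
    deriv (deriv (deriv xi)) (-t) = -deriv (deriv (deriv xi)) t := by
  rw [deriv_deriv_deriv_xi h, deriv_deriv_deriv_xi (by rwa [Real.cos_neg]), Real.tan_neg]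
  ring

theorem stmt_14 :
    (∀ t ∈ Ioo (-(π / 2)) 0, deriv (deriv (deriv xi)) t < 0) ∧
    (∀ t ∈ Ioo 0 (π / 2), 0 < deriv (deriv (deriv xi)) t) := by
  refine ⟨fun t ht => ?_, fun t ht => deriv_deriv_deriv_xi_pos ht.1 ht.2⟩
  have hc : cos t ≠ 0 := (Real.cos_pos_of_mem_Ioo ⟨ht.1, by linarith [ht.2, Real.pi_pos]⟩).ne'
  have hpos := deriv_deriv_deriv_xi_pos (t := -t) (by linarith [ht.2]) (by linarith [ht.1])
  rw [deriv_deriv_deriv_xi_neg hc] at hpos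
  linarith
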